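/- Let Ω = {(q1,q2,q3,q4) ∈ ℝ⁴ : 0 < q2 < π, 0 < q3 < π, q4 > 0} and ρ = (q4)³·sin²(q3)·sin(q2). Let Δ₄ f = ρ⁻¹·Σ_{a,b=1}^{4} ∂_a(ρ·g^{ab}·∂_b f) with g^{11} = 64/((q4)²·sin²q3·sin²q2), g^{22} = 16/((q4)²·sin²q3), g^{33} = 4/(q4)², g^{44} = 1, and let Δ_{H3} f = ρ⁻¹·Σ_{a,b=1}^{4} ∂_a(ρ·H^{ab}·∂_b f) with H^{33} = 1, H^{22} = 4/sin²q3, H^{11} = 16/(sin²q3·sin²q2), all other components zero. For any C ∈ ℝ set E = 3·(1 + sin²q3)/((q4)²·sin²q3) + C·(q4)². Then the operators A f = Δ₄ f + E·f and B f = Δ_{H3} f + (3/(4·sin²q3))·f commute: A(Bf) = B(Af) for every smooth f : Ω → ℝ. -/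

import Mathlib

open Real

/-- Partial derivative of `f` with respect to the `i`-th coordinate. -/
noncomputable def pd {n : ℕ} (i : Fin n) (f : (Fin n → ℝ) → ℝ) (x : Fin n → ℝ) : ℝ :=
  deriv (fun t => f (Function.update x i t)) (x i)

/-- The operator `f ↦ ρ⁻¹ ∑ a b, ∂_a (ρ K^{ab} ∂_b f)` (Laplace–Beltrami-type
quantization of the symmetric tensor field `K` with respect to the weight `ρ`). -/
noncomputable def lapOp {n : ℕ} (ρ : (Fin n → ℝ) → ℝ) (K : (Fin n → ℝ) → Fin n → Fin n → ℝ)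
    (f : (Fin n → ℝ) → ℝ) (x : Fin n → ℝ) : ℝ :=
  (ρ x)⁻¹ * ∑ a, ∑ b, pd a (fun y => ρ y * K y a b * pd b f y) x

/-- Weight `ρ = (q4)³ sin²(q3) sin(q2)`. -/
noncomputable def rho (x : Fin 4 → ℝ) : ℝ := (x 3)^3 * (sin (x 2))^2 * sin (x 1)

/-- Inverse metric of `H4`. -/
noncomputable def gmat (x : Fin 4 → ℝ) : Fin 4 → Fin 4 → ℝ :=
  ![![64/((x 3)^2 * (sin (x 2))^2 * (sin (x 1))^2), 0, 0, 0],
    ![0, 16/((x 3)^2 * (sin (x 2))^2), 0, 0],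
    ![0, 0, 4/(x 3)^2, 0],
    ![0, 0, 0, 1]]

/-- The Killing tensor of the Stäckel first integral `H3`, in four dimensions. -/
noncomputable def H3mat (x : Fin 4 → ℝ) : Fin 4 → Fin 4 → ℝ :=
  ![![16/((sin (x 2))^2 * (sin (x 1))^2), 0, 0, 0],
    ![0, 4/(sin (x 2))^2, 0, 0],
    ![0, 0, 1, 0],
    ![0, 0, 0, 0]]

/-- Quantum correction `E` for `H4`. -/
noncomputable def corrE (C : ℝ) (x : Fin 4 → ℝ) : ℝ :=
  3 * (1 + (sin (x 2))^2)/((x 3)^2 * (sin (x 2))^2) + C * (x 3)^2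

/-- `A f = Δ₄ f + E f`. -/
noncomputable def opA (C : ℝ) (f : (Fin 4 → ℝ) → ℝ) (x : Fin 4 → ℝ) : ℝ :=
  lapOp rho gmat f x + corrE C x * f x

/-- `B f = Δ_{H3} f + (3/(4 sin²q3)) f`. -/
noncomputable def opB (f : (Fin 4 → ℝ) → ℝ) (x : Fin 4 → ℝ) : ℝ :=
  lapOp rho H3mat f x + (3/(4 * (sin (x 2))^2)) * f x

section PartialDerivatives

variable {n : ℕ} {U : Set (Fin n → ℝ)} {f g w : (Fin n → ℝ) → ℝ} {i j : Fin n}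

/-- The value of `w` does not depend on the `i`-th coordinate. -/
def IndepOf (i : Fin n) (w : (Fin n → ℝ) → ℝ) : Prop :=
  ∀ x t, w (Function.update x i t) = w x

theorem pd_congr (hU : IsOpen U) (h : Set.EqOn f g U) : Set.EqOn (pd i f) (pd i g) U := by
  intro x hx
  refine Filter.EventuallyEq.deriv_eq ?_
  have hc : ContinuousAt (fun t => Function.update x i t) (x i) := by fun_prop
  have hm : U ∈ nhds (Function.update x i (x i)) := by
    rw [Function.update_eq_self]; exact hU.mem_nhds hx
  filter_upwards [hc hm] with t ht using h ht

theorem pd_indep_mul (hw : IndepOf i w) (f : (Fin n → ℝ) → ℝ) (x : Fin n → ℝ) :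
    pd i (fun y => w y * f y) x = w x * pd i f x := by
  simp only [pd, hw x, deriv_const_mul_field']

theorem hasDerivAt_update_line {x : Fin n → ℝ} (hf : DifferentiableAt ℝ f x) :
    HasDerivAt (fun t => f (Function.update x i t)) (fderiv ℝ f x (Pi.single i 1)) (x i) := by
  have h := hasDerivAt_update x i (x i)
  rw [← Function.update_eq_self i x] at hf
  have := hf.hasFDerivAt.comp_hasDerivAt (x i) h
  rwa [Function.update_eq_self] at this

theorem pd_eq_fderiv {x : Fin n → ℝ} (hf : DifferentiableAt ℝ f x) :
    pd i f x = fderiv ℝ f x (Pi.single i 1) :=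
  (hasDerivAt_update_line hf).deriv

theorem pd_add {x : Fin n → ℝ} (hf : DifferentiableAt ℝ f x) (hg : DifferentiableAt ℝ g x) :
    pd i (fun y => f y + g y) x = pd i f x + pd i g x := by
  rw [pd_eq_fderiv hf, pd_eq_fderiv hg]
  exact ((hasDerivAt_update_line hf).add (hasDerivAt_update_line hg)).deriv

theorem differentiableAt_of_smooth (hU : IsOpen U) (hf : ContDiffOn ℝ (⊤ : ℕ∞) f U)
    {x : Fin n → ℝ} (hx : x ∈ U) : DifferentiableAt ℝ f x :=
  (hf.contDiffAt (hU.mem_nhds hx)).differentiableAt (by simp)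

theorem contDiffOn_pd (hU : IsOpen U) (hf : ContDiffOn ℝ (⊤ : ℕ∞) f U) :
    ContDiffOn ℝ (⊤ : ℕ∞) (pd i f) U := by
  have h : ContDiffOn ℝ (⊤ : ℕ∞) (fderiv ℝ f) U := hf.fderiv_of_isOpen hU (by simp)
  exact (h.clm_apply contDiffOn_const).congr
    fun x hx => pd_eq_fderiv (differentiableAt_of_smooth hU hf hx)

theorem pd_comm (hU : IsOpen U) (hf : ContDiffOn ℝ (⊤ : ℕ∞) f U) :
    Set.EqOn (pd i (pd j f)) (pd j (pd i f)) U := by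
  have key : ∀ a b : Fin n, ∀ x ∈ U,
      pd a (pd b f) x = fderiv ℝ (fderiv ℝ f) x (Pi.single a 1) (Pi.single b 1) := by
    intro a b x hx
    have h : ContDiffOn ℝ (⊤ : ℕ∞) (fderiv ℝ f) U := hf.fderiv_of_isOpen hU (by simp)
    have hd : DifferentiableAt ℝ (fderiv ℝ f) x :=
      (h.contDiffAt (hU.mem_nhds hx)).differentiableAt (by simp)
    have hb : Set.EqOn (pd b f) (fun y => fderiv ℝ f y (Pi.single b 1)) U :=
      fun y hy => pd_eq_fderiv (differentiableAt_of_smooth hU hf hy)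
    rw [pd_congr hU hb hx, pd_eq_fderiv (hd.clm_apply (differentiableAt_const _)),
      fderiv_clm_apply hd (differentiableAt_const _)]
    simp
  intro x hx
  rw [key i j x hx, key j i x hx]
  refine ((hf.contDiffAt (hU.mem_nhds hx)).isSymmSndFDerivAt ?_).eq _ _
  rw [minSmoothness_of_isRCLikeNormedField]
  exact WithTop.coe_le_coe.2 (le_top : (2 : ℕ∞) ≤ ⊤)

end PartialDerivatives

section DivergenceForm

variable {n : ℕ} {U : Set (Fin n → ℝ)} {f g u v w : (Fin n → ℝ) → ℝ} {a i : Fin n}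

/-- The one-dimensional divergence-form operator `f ↦ u ∂_a (v ∂_a f)`. -/
noncomputable def divForm (a : Fin n) (u v f : (Fin n → ℝ) → ℝ) (x : Fin n → ℝ) : ℝ :=
  u x * pd a (fun y => v y * pd a f y) x

theorem divForm_congr (hU : IsOpen U) (h : Set.EqOn f g U) :
    Set.EqOn (divForm a u v f) (divForm a u v g) U := by
  intro x hx
  have h' : Set.EqOn (fun y => v y * pd a f y) (fun y => v y * pd a g y) U := fun y hy => by
    simp only [pd_congr hU h hy]
  rw [divForm, divForm, pd_congr hU h' hx]

theorem divForm_indep_mul (hw : IndepOf a w) (f : (Fin n → ℝ) → ℝ) (x : Fin n → ℝ) :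
    divForm a u v (fun y => w y * f y) x = w x * divForm a u v f x := by
  have h : (fun y => v y * pd a (fun z => w z * f z) y) = fun y => w y * (v y * pd a f y) := by
    funext y
    rw [pd_indep_mul hw]
    ring
  rw [divForm, h, pd_indep_mul hw, divForm]
  ring

theorem contDiffOn_divForm (hU : IsOpen U) (hu : ContDiffOn ℝ (⊤ : ℕ∞) u U)
    (hv : ContDiffOn ℝ (⊤ : ℕ∞) v U) (hf : ContDiffOn ℝ (⊤ : ℕ∞) f U) :
    ContDiffOn ℝ (⊤ : ℕ∞) (divForm a u v f) U :=
  hu.mul (contDiffOn_pd hU (hv.mul (contDiffOn_pd hU hf)))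

theorem divForm_add (hU : IsOpen U) (hv : ContDiffOn ℝ (⊤ : ℕ∞) v U)
    (hf : ContDiffOn ℝ (⊤ : ℕ∞) f U) (hg : ContDiffOn ℝ (⊤ : ℕ∞) g U) :
    Set.EqOn (divForm a u v (fun y => f y + g y))
      (fun y => divForm a u v f y + divForm a u v g y) U := by
  intro x hx
  have h : Set.EqOn (fun y => v y * pd a (fun z => f z + g z) y)
      (fun y => v y * pd a f y + v y * pd a g y) U := by
    intro y hy
    simp only [pd_add (differentiableAt_of_smooth hU hf hy) (differentiableAt_of_smooth hU hg hy)]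
    ring
  simp only [divForm]
  rw [pd_congr hU h hx, pd_add
    (differentiableAt_of_smooth hU (hv.mul (contDiffOn_pd hU hf)) hx)
    (differentiableAt_of_smooth hU (hv.mul (contDiffOn_pd hU hg)) hx)]
  ring

theorem pd_divForm (hU : IsOpen U) (hui : IndepOf i u) (hvi : IndepOf i v)
    (hv : ContDiffOn ℝ (⊤ : ℕ∞) v U) (hf : ContDiffOn ℝ (⊤ : ℕ∞) f U) :
    Set.EqOn (pd i (divForm a u v f)) (divForm a u v (pd i f)) U := by
  intro x hx
  have h : Set.EqOn (pd i (fun y => v y * pd a f y)) (fun y => v y * pd a (pd i f) y) U := by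
    intro y hy
    rw [pd_indep_mul hvi, pd_comm hU hf hy]
  change pd i (fun y => u y * pd a (fun y => v y * pd a f y) y) x = _
  rw [pd_indep_mul hui, pd_comm hU (hv.mul (contDiffOn_pd hU hf)) hx, pd_congr hU h hx, divForm]

end DivergenceForm

/-- The coordinate domain `0 < q2, q3 < π`, `0 < q4`. -/
def coordDomain : Set (Fin 4 → ℝ) :=
  {x | (0 < x 1 ∧ x 1 < π) ∧ (0 < x 2 ∧ x 2 < π) ∧ 0 < x 3}

theorem isOpen_coordDomain : IsOpen coordDomain := by
  have h : ∀ i : Fin 4, Continuous fun x : Fin 4 → ℝ => x i := fun i => continuous_apply i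
  exact ((isOpen_lt continuous_const (h 1)).inter (isOpen_lt (h 1) continuous_const)).inter
    (((isOpen_lt continuous_const (h 2)).inter (isOpen_lt (h 2) continuous_const)).inter
      (isOpen_lt continuous_const (h 3)))

theorem sin_one_pos {x : Fin 4 → ℝ} (hx : x ∈ coordDomain) : 0 < sin (x 1) :=
  sin_pos_of_pos_of_lt_pi hx.1.1 hx.1.2

theorem sin_two_pos {x : Fin 4 → ℝ} (hx : x ∈ coordDomain) : 0 < sin (x 2) :=
  sin_pos_of_pos_of_lt_pi hx.2.1.1 hx.2.1.2

/-- The angular part `sin²(q3) sin(q2)` of `rho`. -/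
noncomputable def angRho (x : Fin 4 → ℝ) : ℝ := (sin (x 2))^2 * sin (x 1)

/-- The diagonal entries of `H3mat`, multiplied by `angRho`. -/
noncomputable def angCoeff (a : Fin 4) (x : Fin 4 → ℝ) : ℝ := angRho x * H3mat x a a

/-- The form of `opB` in which no coefficient depends on `q4`. -/
noncomputable def angOp (f : (Fin 4 → ℝ) → ℝ) (x : Fin 4 → ℝ) : ℝ :=
  divForm 0 (fun y => (angRho y)⁻¹) (angCoeff 0) f x
    + divForm 1 (fun y => (angRho y)⁻¹) (angCoeff 1) f x
    + divForm 2 (fun y => (angRho y)⁻¹) (angCoeff 2) f x + 3 / (4 * (sin (x 2))^2) * f x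

/-- The part of `opA` involving only `q4`. -/
noncomputable def radOp (C : ℝ) (f : (Fin 4 → ℝ) → ℝ) (x : Fin 4 → ℝ) : ℝ :=
  divForm 3 (fun y => ((y 3)^3)⁻¹) (fun y => (y 3)^3) f x + (3 / (x 3)^2 + C * (x 3)^2) * f x

theorem angRho_ne_zero {x : Fin 4 → ℝ} (hx : x ∈ coordDomain) : angRho x ≠ 0 :=
  (mul_pos (pow_pos (sin_two_pos hx) 2) (sin_one_pos hx)).ne'

theorem indepOf_three_angRho : IndepOf 3 angRho := fun x t => by simp [angRho]

theorem indepOf_three_inv_angRho : IndepOf 3 (fun y => (angRho y)⁻¹) :=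
  fun x t => by simp [angRho]

theorem indepOf_three_angCoeff (a : Fin 4) : IndepOf 3 (angCoeff a) := fun x t => by
  simp [angCoeff, angRho, H3mat]

theorem indepOf_of_ne_three {a : Fin 4} (ha : a ≠ 3) (φ : ℝ → ℝ) :
    IndepOf a (fun y : Fin 4 → ℝ => φ (y 3)) := fun x t => by
  simp [Function.update_of_ne ha.symm]

theorem contDiffOn_angRho : ContDiffOn ℝ (⊤ : ℕ∞) angRho coordDomain := by
  unfold angRho
  fun_prop

theorem contDiffOn_inv_angRho :
    ContDiffOn ℝ (⊤ : ℕ∞) (fun y => (angRho y)⁻¹) coordDomain :=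
  contDiffOn_angRho.inv fun _ hx => angRho_ne_zero hx

theorem contDiffOn_angCoeff (a : Fin 4) : ContDiffOn ℝ (⊤ : ℕ∞) (angCoeff a) coordDomain := by
  refine contDiffOn_angRho.mul ?_
  have h1 : ∀ x ∈ coordDomain, sin (x 1) ≠ 0 := fun x hx => (sin_one_pos hx).ne'
  have h2 : ∀ x ∈ coordDomain, sin (x 2) ≠ 0 := fun x hx => (sin_two_pos hx).ne'
  fin_cases a <;> simp only [H3mat, Matrix.cons_val, Fin.zero_eta, Fin.mk_one, Fin.reduceFinMk]
  · exact contDiffOn_const.div (by fun_prop) fun x hx => by simp [h1 x hx, h2 x hx]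
  · exact contDiffOn_const.div (by fun_prop) fun x hx => by simp [h2 x hx]
  · exact contDiffOn_const
  · exact contDiffOn_const

theorem contDiffOn_angPot :
    ContDiffOn ℝ (⊤ : ℕ∞) (fun x : Fin 4 → ℝ => 3 / (4 * (sin (x 2))^2)) coordDomain :=
  contDiffOn_const.div (by fun_prop) fun x hx => by simp [(sin_two_pos hx).ne']

theorem indepOf_three_angPot : IndepOf 3 (fun x : Fin 4 → ℝ => 3 / (4 * (sin (x 2))^2)) :=
  fun x t => by simp

section AngularOperator

variable {f g : (Fin 4 → ℝ) → ℝ}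

theorem angOp_congr (h : Set.EqOn f g coordDomain) :
    Set.EqOn (angOp f) (angOp g) coordDomain := by
  intro x hx
  simp only [angOp, divForm_congr isOpen_coordDomain h hx, h hx]

theorem angOp_radial_mul (φ : ℝ → ℝ) (f : (Fin 4 → ℝ) → ℝ) (x : Fin 4 → ℝ) :
    angOp (fun y => φ (y 3) * f y) x = φ (x 3) * angOp f x := by
  simp only [angOp]
  rw [divForm_indep_mul (indepOf_of_ne_three (by decide) φ),
    divForm_indep_mul (indepOf_of_ne_three (by decide) φ),
    divForm_indep_mul (indepOf_of_ne_three (by decide) φ)]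
  ring

theorem contDiffOn_angOp (hf : ContDiffOn ℝ (⊤ : ℕ∞) f coordDomain) :
    ContDiffOn ℝ (⊤ : ℕ∞) (angOp f) coordDomain := by
  have h : ∀ a, ContDiffOn ℝ (⊤ : ℕ∞)
      (divForm a (fun y => (angRho y)⁻¹) (angCoeff a) f) coordDomain := fun a =>
    contDiffOn_divForm isOpen_coordDomain contDiffOn_inv_angRho (contDiffOn_angCoeff a) hf
  exact (((h 0).add (h 1)).add (h 2)).add (contDiffOn_angPot.mul hf)

theorem angOp_add (hf : ContDiffOn ℝ (⊤ : ℕ∞) f coordDomain)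
    (hg : ContDiffOn ℝ (⊤ : ℕ∞) g coordDomain) :
    Set.EqOn (angOp (fun y => f y + g y)) (fun y => angOp f y + angOp g y) coordDomain := by
  intro x hx
  simp only [angOp, divForm_add isOpen_coordDomain (contDiffOn_angCoeff _) hf hg hx]
  ring

theorem pd_three_angOp (hf : ContDiffOn ℝ (⊤ : ℕ∞) f coordDomain) :
    Set.EqOn (pd 3 (angOp f)) (angOp (pd 3 f)) coordDomain := by
  intro x hx
  have h : ∀ a, ContDiffOn ℝ (⊤ : ℕ∞)
      (divForm a (fun y => (angRho y)⁻¹) (angCoeff a) f) coordDomain := fun a =>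
    contDiffOn_divForm isOpen_coordDomain contDiffOn_inv_angRho (contDiffOn_angCoeff a) hf
  have hd : ∀ {k : (Fin 4 → ℝ) → ℝ}, ContDiffOn ℝ (⊤ : ℕ∞) k coordDomain →
      DifferentiableAt ℝ k x := fun hk => differentiableAt_of_smooth isOpen_coordDomain hk hx
  have hp : ∀ a, pd 3 (divForm a (fun y => (angRho y)⁻¹) (angCoeff a) f) x
      = divForm a (fun y => (angRho y)⁻¹) (angCoeff a) (pd 3 f) x := fun a =>
    pd_divForm isOpen_coordDomain indepOf_three_inv_angRho (indepOf_three_angCoeff a)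
      (contDiffOn_angCoeff a) hf hx
  unfold angOp
  rw [pd_add (hd (((h 0).add (h 1)).add (h 2))) (hd (contDiffOn_angPot.mul hf)),
    pd_add (hd ((h 0).add (h 1))) (hd (h 2)), pd_add (hd (h 0)) (hd (h 1)),
    pd_indep_mul indepOf_three_angPot, hp, hp, hp]

theorem contDiffOn_radial {φ : ℝ → ℝ} (hφ : ContDiffOn ℝ (⊤ : ℕ∞) φ (Set.Ioi 0)) :
    ContDiffOn ℝ (⊤ : ℕ∞) (fun x : Fin 4 → ℝ => φ (x 3)) coordDomain :=
  hφ.comp (by fun_prop) fun _ hx => hx.2.2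

theorem contDiffOn_inv_pow (k : ℕ) :
    ContDiffOn ℝ (⊤ : ℕ∞) (fun t : ℝ => (t ^ k)⁻¹) (Set.Ioi 0) :=
  ContDiffOn.inv (by fun_prop) fun _ ht => (pow_pos ht k).ne'

theorem contDiffOn_radPot (C : ℝ) :
    ContDiffOn ℝ (⊤ : ℕ∞) (fun t : ℝ => 3 / t ^ 2 + C * t ^ 2) (Set.Ioi 0) := by
  simp only [div_eq_mul_inv]
  exact (contDiffOn_const.mul (contDiffOn_inv_pow 2)).add (by fun_prop)

theorem contDiffOn_radDivForm (hf : ContDiffOn ℝ (⊤ : ℕ∞) f coordDomain) :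
    ContDiffOn ℝ (⊤ : ℕ∞)
      (divForm 3 (fun y : Fin 4 → ℝ => ((y 3)^3)⁻¹) (fun y => (y 3)^3) f) coordDomain :=
  contDiffOn_divForm isOpen_coordDomain (contDiffOn_radial (contDiffOn_inv_pow 3))
    (by fun_prop) hf

theorem contDiffOn_radOp (C : ℝ) (hf : ContDiffOn ℝ (⊤ : ℕ∞) f coordDomain) :
    ContDiffOn ℝ (⊤ : ℕ∞) (radOp C f) coordDomain :=
  (contDiffOn_radDivForm hf).add ((contDiffOn_radial (contDiffOn_radPot C)).mul hf)

theorem radOp_angOp_comm (C : ℝ) (hf : ContDiffOn ℝ (⊤ : ℕ∞) f coordDomain) :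
    Set.EqOn (radOp C (angOp f)) (angOp (radOp C f)) coordDomain := by
  intro x hx
  have hO := isOpen_coordDomain
  have hs : ContDiffOn ℝ (⊤ : ℕ∞) (fun y : Fin 4 → ℝ => (y 3)^3 * pd 3 f y) coordDomain :=
    ContDiffOn.mul (by fun_prop) (contDiffOn_pd hO hf)
  have h1 : Set.EqOn (fun y => (y 3)^3 * pd 3 (angOp f) y)
      (angOp (fun y => (y 3)^3 * pd 3 f y)) coordDomain := by
    intro y hy
    simp only [pd_three_angOp hf hy]
    exact (angOp_radial_mul (fun t => t ^ 3) (pd 3 f) y).symm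
  have h2 : divForm 3 (fun y : Fin 4 → ℝ => ((y 3)^3)⁻¹) (fun y => (y 3)^3) (angOp f) x
      = angOp (divForm 3 (fun y => ((y 3)^3)⁻¹) (fun y => (y 3)^3) f) x := by
    unfold divForm
    rw [pd_congr hO h1 hx, pd_three_angOp hs hx]
    exact (angOp_radial_mul (fun t => (t ^ 3)⁻¹) _ x).symm
  have h3 := angOp_add (contDiffOn_radDivForm hf)
    ((contDiffOn_radial (contDiffOn_radPot C)).mul hf) hx
  have h4 := angOp_radial_mul (fun t => 3 / t ^ 2 + C * t ^ 2) f x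
  simp only at h3 h4
  unfold radOp
  rw [h3, h4, h2]

end AngularOperator

theorem rho_eq (x : Fin 4 → ℝ) : rho x = (x 3)^3 * angRho x := by
  rw [rho, angRho]
  ring

theorem pd_zero_fun {n : ℕ} (i : Fin n) (x : Fin n → ℝ) : pd i (fun _ => 0) x = 0 := by
  simp [pd]

/-- For a diagonal tensor, only the diagonal terms contribute to `lapOp`. -/
theorem lapOp_of_diagonal {n : ℕ} {ρ : (Fin n → ℝ) → ℝ}
    {K : (Fin n → ℝ) → Fin n → Fin n → ℝ} (hK : ∀ x a b, a ≠ b → K x a b = 0)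
    (f : (Fin n → ℝ) → ℝ) (x : Fin n → ℝ) :
    lapOp ρ K f x = (ρ x)⁻¹ * ∑ a, pd a (fun y => ρ y * K y a a * pd a f y) x := by
  rw [lapOp]
  congr 1
  refine Finset.sum_congr rfl fun a _ => Finset.sum_eq_single a (fun b _ hb => ?_) (by simp)
  simp [hK _ a b hb.symm, pd_zero_fun]

theorem H3mat_diagonal (x : Fin 4 → ℝ) (a b : Fin 4) (h : a ≠ b) : H3mat x a b = 0 := by
  fin_cases a <;> fin_cases b <;> simp_all [H3mat]

theorem gmat_diagonal (x : Fin 4 → ℝ) (a b : Fin 4) (h : a ≠ b) : gmat x a b = 0 := by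
  fin_cases a <;> fin_cases b <;> simp_all [gmat]

theorem gmat_eq_H3mat {a : Fin 4} (ha : a ≠ 3) (x : Fin 4 → ℝ) :
    gmat x a a = 4 / (x 3)^2 * H3mat x a a := by
  fin_cases a <;> simp [gmat, H3mat] at ha ⊢ <;> ring

theorem pd_radial_mul {a : Fin 4} (ha : a ≠ 3) (φ : ℝ → ℝ) (f : (Fin 4 → ℝ) → ℝ)
    {x : Fin 4 → ℝ} (hx : angRho x ≠ 0) :
    pd a (fun y => φ (y 3) * (angCoeff a y * pd a f y)) x
      = φ (x 3) * (angRho x * divForm a (fun y => (angRho y)⁻¹) (angCoeff a) f x) := by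
  rw [pd_indep_mul (indepOf_of_ne_three ha φ), divForm, mul_inv_cancel_left₀ hx]

theorem opB_eq_angOp (f : (Fin 4 → ℝ) → ℝ) : Set.EqOn (opB f) (angOp f) coordDomain := by
  intro x hx
  have hr : x 3 ≠ 0 := hx.2.2.ne'
  have hσ := angRho_ne_zero hx
  have h : ∀ a : Fin 4, a ≠ 3 → pd a (fun y => rho y * H3mat y a a * pd a f y) x
      = (x 3)^3 * (angRho x * divForm a (fun y => (angRho y)⁻¹) (angCoeff a) f x) := by
    intro a ha
    rw [← pd_radial_mul ha (fun t => t ^ 3) f hσ]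
    congr 1
    funext y
    rw [rho_eq, angCoeff]
    ring
  have h3 : pd 3 (fun y => rho y * H3mat y 3 3 * pd 3 f y) x = 0 := by
    simp [H3mat, pd_zero_fun]
  rw [opB, lapOp_of_diagonal H3mat_diagonal, Fin.sum_univ_four, h 0 (by decide),
    h 1 (by decide), h 2 (by decide), h3, rho_eq, angOp]
  field_simp
  ring

theorem opA_eq (C : ℝ) (f : (Fin 4 → ℝ) → ℝ) :
    Set.EqOn (opA C f) (fun x => radOp C f x + 4 / (x 3)^2 * angOp f x) coordDomain := by
  intro x hx
  have hr : x 3 ≠ 0 := hx.2.2.ne'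
  have hσ := angRho_ne_zero hx
  have hs : sin (x 2) ≠ 0 := (sin_two_pos hx).ne'
  have h : ∀ a : Fin 4, a ≠ 3 → pd a (fun y => rho y * gmat y a a * pd a f y) x
      = (x 3)^3 * (4 / (x 3)^2)
        * (angRho x * divForm a (fun y => (angRho y)⁻¹) (angCoeff a) f x) := by
    intro a ha
    rw [← pd_radial_mul ha (fun t => t ^ 3 * (4 / t ^ 2)) f hσ]
    congr 1
    funext y
    rw [rho_eq, angCoeff, gmat_eq_H3mat ha]
    ring
  have h3 : pd 3 (fun y => rho y * gmat y 3 3 * pd 3 f y) x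
      = angRho x * pd 3 (fun y => (y 3)^3 * pd 3 f y) x := by
    rw [← pd_indep_mul indepOf_three_angRho]
    congr 1
    funext y
    simp only [rho_eq, gmat, Matrix.cons_val]
    ring
  rw [opA, lapOp_of_diagonal gmat_diagonal, Fin.sum_univ_four, h 0 (by decide),
    h 1 (by decide), h 2 (by decide), h3, rho_eq]
  simp only [angOp, radOp, corrE]
  rw [divForm.eq_1 3]
  field_simp
  ring

theorem stmt_14 (C : ℝ) (f : (Fin 4 → ℝ) → ℝ)
    (hf : ContDiffOn ℝ (⊤ : ℕ∞) f {x : Fin 4 → ℝ | (0 < x 1 ∧ x 1 < π) ∧ (0 < x 2 ∧ x 2 < π) ∧ 0 < x 3}) :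
    ∀ x : Fin 4 → ℝ, 0 < x 1 → x 1 < π → 0 < x 2 → x 2 < π → 0 < x 3 →
      opA C (opB f) x = opB (opA C f) x := by
  intro x h1 h1' h2 h2' h3
  have hx : x ∈ coordDomain := ⟨⟨h1, h1'⟩, ⟨h2, h2'⟩, h3⟩
  replace hf : ContDiffOn ℝ (⊤ : ℕ∞) f coordDomain := hf
  have hB : Set.EqOn (opB f) (angOp f) coordDomain := opB_eq_angOp f
  have hrad : radOp C (opB f) x = radOp C (angOp f) x := by
    simp only [radOp, divForm_congr isOpen_coordDomain hB hx, hB hx]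
  have hw : ContDiffOn ℝ (⊤ : ℕ∞) (fun y : Fin 4 → ℝ => 4 / (y 3)^2) coordDomain :=
    contDiffOn_const.div (by fun_prop) fun y hy => pow_ne_zero 2 hy.2.2.ne'
  have hadd := angOp_add (contDiffOn_radOp C hf) (hw.mul (contDiffOn_angOp hf)) hx
  have hmul := angOp_radial_mul (fun t => 4 / t ^ 2) (angOp f) x
  simp only at hadd hmul
  rw [opA_eq C _ hx, opB_eq_angOp _ hx, angOp_congr (opA_eq C f) hx, hadd, hmul]
  simp only [hrad, angOp_congr hB hx, radOp_angOp_comm C hf hx]
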